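/- arXiv:1601.00639 — 5 statements merged into one kernel-verified Lean document; each statement's English description precedes it below -/
import Mathlib

section
/- Let (M, 𝓕, σ) be a σ-finite measure space, let (Ω, 𝓑, P) be a probability space, and let W_A ∈ L²(Ω, P; ℝ) be given for each A ∈ 𝓕 with σ(A) < ∞, satisfying E[W_A W_B] = σ(A ∩ B) for all such A, B. Then there exists a linear isometry I : L²(M, σ; ℝ) → L²(Ω, P; ℝ) such that I(χ_A) = W_A (as elements of L²(Ω, P)) for every A ∈ 𝓕 with σ(A) < ∞; in particular E[(I f)²] = ∫_M |f(x)|² dσ(x) for all f ∈ L²(M, σ; ℝ) (the Wiener/Ito isometry ∫_M f dW). -/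
open MeasureTheory

/-- Square of the `L²` norm as an integral. -/
lemma wi_integral_sq {X : Type*} [MeasurableSpace X] (μ : Measure X) (f : Lp ℝ 2 μ) :
    ∫ x, (f : X → ℝ) x ^ 2 ∂μ = ‖f‖ ^ 2 := by
  rw [← real_inner_self_eq_norm_sq, L2.inner_def]
  simp [pow_two]

/-- Two families with the same Gram matrix have linear combinations of the same norm. -/
lemma wi_norm_eq {ι E F : Type*} [NormedAddCommGroup E] [InnerProductSpace ℝ E]
    [NormedAddCommGroup F] [InnerProductSpace ℝ F] (v : ι → E) (w : ι → F)
    (h : ∀ i j, inner ℝ (w i) (w j) = inner ℝ (v i) (v j)) (l : ι →₀ ℝ) :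
    ‖Finsupp.linearCombination ℝ w l‖ = ‖Finsupp.linearCombination ℝ v l‖ := by
  rw [← sq_eq_sq₀ (norm_nonneg _) (norm_nonneg _), ← real_inner_self_eq_norm_sq,
    ← real_inner_self_eq_norm_sq]
  simp only [Finsupp.linearCombination_apply, Finsupp.sum, sum_inner, inner_sum,
    real_inner_smul_left, real_inner_smul_right, h]

/-- Linear combinations of indicators are dense in `L²`. -/
lemma wi_dense {M : Type*} [MeasurableSpace M] (σ : Measure M) :
    DenseRange (Finsupp.linearCombination ℝ
      (fun A : {A : Set M // MeasurableSet A ∧ σ A ≠ ⊤} =>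
        (indicatorConstLp 2 A.2.1 A.2.2 (1 : ℝ) : Lp ℝ 2 σ))) := by
  set e := Finsupp.linearCombination ℝ
      (fun A : {A : Set M // MeasurableSet A ∧ σ A ≠ ⊤} =>
        (indicatorConstLp 2 A.2.1 A.2.2 (1 : ℝ) : Lp ℝ 2 σ)) with he
  have key : ∀ f : Lp ℝ 2 σ, f ∈ (LinearMap.range e).topologicalClosure := by
    intro f
    refine Lp.induction (by simp) (fun f : Lp ℝ 2 σ => f ∈ (LinearMap.range e).topologicalClosure)
      ?_ ?_ ?_ f
    · intro c s hs hμs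
      apply Submodule.le_topologicalClosure
      refine ⟨Finsupp.single ⟨s, hs, hμs.ne⟩ c, ?_⟩
      rw [he, Finsupp.linearCombination_single, Lp.simpleFunc.coe_indicatorConst]
      apply Lp.ext
      filter_upwards [Lp.coeFn_smul c (indicatorConstLp 2 hs hμs.ne (1 : ℝ) : Lp ℝ 2 σ),
        indicatorConstLp_coeFn (p := 2) (hs := hs) (hμs := hμs.ne) (c := (1 : ℝ)),
        indicatorConstLp_coeFn (p := 2) (hs := hs) (hμs := hμs.ne) (c := c)] with x h1 h2 h3
      rw [h1, h3, Pi.smul_apply, h2]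
      by_cases hx : x ∈ s <;> simp [hx]
    · intro f g hf hg _ h1 h2
      exact Submodule.add_mem _ h1 h2
    · exact Submodule.isClosed_topologicalClosure _
  intro f
  have h := key f
  rw [← SetLike.mem_coe, Submodule.topologicalClosure_coe, LinearMap.coe_range] at h
  exact h

/-- Wiener/Ito isometry: given centered random variables `W A ∈ L²(Ω,P)` indexed by the
sets of finite `σ`-measure with `E[W_A W_B] = σ(A ∩ B)`, there is a linear isometry
`I : L²(M,σ) → L²(Ω,P)` with `I(χ_A) = W_A`; in particular
`E[(I f)²] = ∫ |f|² dσ`. -/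
theorem exists_wiener_ito_isometry
    {M Ω : Type*} [MeasurableSpace M] [MeasurableSpace Ω]
    (σ : Measure M) [SigmaFinite σ] (P : Measure Ω) [IsProbabilityMeasure P]
    (W : ∀ (A : Set M), MeasurableSet A → σ A ≠ ⊤ → Lp ℝ 2 P)
    (hcov : ∀ (A B : Set M) (hA : MeasurableSet A) (hB : MeasurableSet B)
        (hA' : σ A ≠ ⊤) (hB' : σ B ≠ ⊤),
      ∫ ω, (W A hA hA' : Ω → ℝ) ω * (W B hB hB' : Ω → ℝ) ω ∂P = (σ (A ∩ B)).toReal) :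
    ∃ I : Lp ℝ 2 σ →ₗᵢ[ℝ] Lp ℝ 2 P,
      (∀ (A : Set M) (hA : MeasurableSet A) (hA' : σ A ≠ ⊤),
        I (indicatorConstLp 2 hA hA' (1 : ℝ)) = W A hA hA') ∧
      (∀ f : Lp ℝ 2 σ,
        ∫ ω, ((I f : Lp ℝ 2 P) : Ω → ℝ) ω ^ 2 ∂P = ∫ x, ((f : M → ℝ) x) ^ 2 ∂σ) := by
  let v : {A : Set M // MeasurableSet A ∧ σ A ≠ ⊤} → Lp ℝ 2 σ :=
    fun A => indicatorConstLp 2 A.2.1 A.2.2 (1 : ℝ)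
  let w : {A : Set M // MeasurableSet A ∧ σ A ≠ ⊤} → Lp ℝ 2 P := fun A => W A.1 A.2.1 A.2.2
  have hvw : ∀ i j, inner ℝ (w i) (w j) = inner ℝ (v i) (v j) := by
    intro i j
    simp only [v]
    rw [L2.real_inner_indicatorConstLp_one_indicatorConstLp_one i.2.1 j.2.1 i.2.2 j.2.2,
      L2.inner_def,
      Measure.real, ← hcov i.1 j.1 i.2.1 j.2.1 i.2.2 j.2.2]
    simp [w, mul_comm]
  have hn := wi_norm_eq v w hvw
  have hd : DenseRange (Finsupp.linearCombination ℝ v) := wi_dense σ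
  have hb : ∃ C : ℝ, ∀ x, ‖Finsupp.linearCombination ℝ w x‖
      ≤ C * ‖Finsupp.linearCombination ℝ v x‖ := ⟨1, fun x => by rw [hn, one_mul]⟩
  let T : Lp ℝ 2 σ →L[ℝ] Lp ℝ 2 P :=
    (Finsupp.linearCombination ℝ w).extendOfNorm (Finsupp.linearCombination ℝ v)
  have hT : ∀ x, T (Finsupp.linearCombination ℝ v x) = Finsupp.linearCombination ℝ w x :=
    fun x => LinearMap.extendOfNorm_eq hd hb x
  have hnorm : ∀ f, ‖T f‖ = ‖f‖ := by
    intro f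
    refine hd.induction_on f (isClosed_eq (by fun_prop) (by fun_prop)) ?_
    intro x
    rw [hT, hn]
  refine ⟨⟨T.toLinearMap, hnorm⟩, ?_, ?_⟩
  · intro A hA hA'
    have := hT (Finsupp.single ⟨A, hA, hA'⟩ 1)
    rw [Finsupp.linearCombination_single, Finsupp.linearCombination_single, one_smul,
      one_smul] at this
    exact this
  · intro f
    rw [wi_integral_sq, wi_integral_sq, LinearIsometry.norm_map]
end

section
/- Let c ∈ ℝ with |c| < 1 and let γ₂^{(c)} be the probability measure on ℝ² with density p_c(x,y) = (1/(2π√(1−c²))) exp(−(x² − 2cxy + y²)/(2(1−c²))) with respect to Lebesgue measure on ℝ², i.e. the centered bivariate Gaussian with covariance matrix [[1, c], [c, 1]]. Then for the probabilists' Hermite polynomials Hₙ, Hₖ one has ∬_{ℝ²} Hₙ(x) Hₖ(y) dγ₂^{(c)}(x,y) = δ_{n,k} · n! · cⁿ for all n, k ∈ ℕ (δ_{n,k} the Kronecker delta). -/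
open MeasureTheory

/-- The centered bivariate Gaussian measure on `ℝ²` with covariance matrix
`[[1, c], [c, 1]]`, `|c| < 1`, given by its density with respect to Lebesgue measure. -/
noncomputable def gaussian2D (c : ℝ) : Measure (ℝ × ℝ) :=
  (volume : Measure (ℝ × ℝ)).withDensity fun p =>
    ENNReal.ofReal
      ((1 / (2 * Real.pi * Real.sqrt (1 - c ^ 2))) *
        Real.exp (-(p.1 ^ 2 - 2 * c * p.1 * p.2 + p.2 ^ 2) / (2 * (1 - c ^ 2))))

open Polynomial in
theorem hermite_derivative_succ (n : ℕ) :
    derivative (hermite (n + 1)) = ((n + 1 : ℕ) : ℤ[X]) * hermite n := by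
  induction n with
  | zero => simp
  | succ n ih =>
    have h1 : hermite (n + 2) = X * hermite (n + 1) - derivative (hermite (n + 1)) :=
      hermite_succ (n + 1)
    have h2 : hermite (n + 1) = X * hermite n - derivative (hermite n) := hermite_succ n
    rw [h1, ih, derivative_sub, derivative_mul, ih, derivative_mul, derivative_natCast,
      derivative_X]
    have h3 : derivative (hermite n) = X * hermite n - hermite (n + 1) := by rw [h2]; ring
    rw [h3]
    push_cast
    ring

theorem poly_gauss_integrable {b : ℝ} (hb : 0 < b) (f : Polynomial ℤ) :
    Integrable fun x : ℝ => (Polynomial.aeval x f : ℝ) * Real.exp (-b * x ^ 2) := by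
  induction f using Polynomial.induction_on' with
  | add p q hp hq =>
    simp only [map_add, add_mul]
    exact hp.add hq
  | monomial n a =>
    have h := integrable_rpow_mul_exp_neg_mul_sq hb
      (s := (n : ℝ)) (by have : (0 : ℝ) ≤ n := Nat.cast_nonneg n
                         linarith)
    have h2 := h.const_mul (a : ℝ)
    simpa [Polynomial.aeval_monomial, mul_assoc] using h2

noncomputable def gw (c : ℝ) (p : ℝ × ℝ) : ℝ :=
  Real.exp (-(p.1 ^ 2 - 2 * c * p.1 * p.2 + p.2 ^ 2) / (2 * (1 - c ^ 2)))

theorem one_sub_sq_pos {c : ℝ} (hc : |c| < 1) : 0 < 1 - c ^ 2 := by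
  have := (sq_lt_one_iff_abs_lt_one c).2 hc
  linarith

theorem gw_continuous (c : ℝ) : Continuous (gw c) := by
  unfold gw
  fun_prop

theorem gw_le {c : ℝ} (hc : |c| < 1) (p : ℝ × ℝ) :
    gw c p ≤ Real.exp (-((1 - |c|) / (2 * (1 - c ^ 2))) * p.1 ^ 2) *
      Real.exp (-((1 - |c|) / (2 * (1 - c ^ 2))) * p.2 ^ 2) := by
  have hs := one_sub_sq_pos hc
  rw [← Real.exp_add, gw, Real.exp_le_exp]
  have h : (1 - |c|) * (p.1 ^ 2 + p.2 ^ 2) ≤ p.1 ^ 2 - 2 * c * p.1 * p.2 + p.2 ^ 2 := by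
    have h1 : 2 * c * p.1 * p.2 ≤ |c| * (p.1 ^ 2 + p.2 ^ 2) := by
      rcases abs_cases c with ⟨h, h'⟩ | ⟨h, h'⟩ <;> rw [h]
      · nlinarith [mul_nonneg h' (sq_nonneg (p.1 - p.2))]
      · nlinarith [mul_nonneg (neg_nonneg.2 h'.le) (sq_nonneg (p.1 + p.2))]
    linarith
  have e : -((1 - |c|) / (2 * (1 - c ^ 2))) * p.1 ^ 2 + -((1 - |c|) / (2 * (1 - c ^ 2))) * p.2 ^ 2
      = (-((1 - |c|) * (p.1 ^ 2 + p.2 ^ 2))) / (2 * (1 - c ^ 2)) := by ring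
  rw [e]
  gcongr

theorem poly_gw_integrable {c : ℝ} (hc : |c| < 1) (f g : Polynomial ℤ) :
    Integrable fun p : ℝ × ℝ =>
      ((Polynomial.aeval p.1 f : ℝ) * (Polynomial.aeval p.2 g : ℝ)) * gw c p := by
  have hs := one_sub_sq_pos hc
  have hb : 0 < (1 - |c|) / (2 * (1 - c ^ 2)) := by
    apply div_pos <;> linarith
  have h := (poly_gauss_integrable hb f).mul_prod (poly_gauss_integrable hb g)
  refine Integrable.mono h ?_ ?_
  · apply Continuous.aestronglyMeasurable
    have := gw_continuous c
    have h1 := f.continuous_aeval (A := ℝ)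
    have h2 := g.continuous_aeval (A := ℝ)
    fun_prop
  · refine Filter.Eventually.of_forall fun p => ?_
    have h0 : 0 ≤ gw c p := (Real.exp_pos _).le
    simp only [norm_mul, Real.norm_eq_abs, abs_of_nonneg h0, Real.abs_exp]
    calc _ ≤ |(Polynomial.aeval p.1 f : ℝ)| * |(Polynomial.aeval p.2 g : ℝ)| * _ :=
          mul_le_mul_of_nonneg_left (gw_le hc p) (by positivity)
      _ = _ := by ring

noncomputable def gI (c : ℝ) (f g : Polynomial ℤ) : ℝ :=
  ∫ p : ℝ × ℝ, ((Polynomial.aeval p.1 f : ℝ) * (Polynomial.aeval p.2 g : ℝ)) * gw c p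

theorem gI_stein {c : ℝ} (hc : |c| < 1) (f g : Polynomial ℤ) :
    gI c (Polynomial.X * f) g =
      gI c (Polynomial.derivative f) g + c * gI c f (Polynomial.derivative g) := by
  have hs := one_sub_sq_pos hc
  have i1 := poly_gw_integrable hc (Polynomial.derivative f) g
  have i2 := (poly_gw_integrable hc f (Polynomial.derivative g)).const_mul c
  have i3 := poly_gw_integrable hc (Polynomial.X * f) g
  have i4 := poly_gw_integrable hc f g
  have key := integral_bilinear_hasLineDerivAt_right_eq_neg_left_of_integrable
    (μ := (volume : Measure (ℝ × ℝ))) (v := ((1 : ℝ), c)) (B := ContinuousLinearMap.mul ℝ ℝ)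
    (f := fun p : ℝ × ℝ => (Polynomial.aeval p.1 f : ℝ) * (Polynomial.aeval p.2 g : ℝ))
    (f' := fun p : ℝ × ℝ =>
      (Polynomial.aeval p.1 (Polynomial.derivative f) : ℝ) * (Polynomial.aeval p.2 g : ℝ)
      + c * ((Polynomial.aeval p.1 f : ℝ) *
        (Polynomial.aeval p.2 (Polynomial.derivative g) : ℝ)))
    (g := gw c) (g' := fun p => -p.1 * gw c p) ?_ ?_ ?_ ?_ ?_
  · simp only [ContinuousLinearMap.mul_apply'] at key
    unfold gI
    rw [← integral_const_mul, ← integral_add i1 i2]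
    have e1 : ∀ p : ℝ × ℝ, (Polynomial.aeval p.1 f : ℝ) * (Polynomial.aeval p.2 g : ℝ)
        * (-p.1 * gw c p) = -((Polynomial.aeval p.1 (Polynomial.X * f) : ℝ) *
          (Polynomial.aeval p.2 g : ℝ) * gw c p) := by
      intro p; simp only [map_mul, Polynomial.aeval_X]; ring
    simp only [e1] at key
    rw [integral_neg, neg_inj] at key
    rw [key]
    congr 1
    ext p
    ring
  · refine (i1.add i2).congr (Filter.Eventually.of_forall fun p => ?_)
    simp only [ContinuousLinearMap.mul_apply', Pi.add_apply]; ring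
  · refine i3.neg.congr (Filter.Eventually.of_forall fun p => ?_)
    simp only [ContinuousLinearMap.mul_apply', Pi.neg_apply, map_mul, Polynomial.aeval_X]; ring
  · simpa only [ContinuousLinearMap.mul_apply'] using i4
  · intro p _
    unfold HasLineDerivAt
    have l1 : HasDerivAt (fun t : ℝ => p.1 + t * 1) 1 0 := by
      simpa using ((hasDerivAt_id (0 : ℝ)).mul_const 1).const_add p.1
    have l2 : HasDerivAt (fun t : ℝ => p.2 + t * c) c 0 := by
      simpa using ((hasDerivAt_id (0 : ℝ)).mul_const c).const_add p.2
    have d1 := (f.hasDerivAt_aeval (p.1 + 0 * 1)).comp (0 : ℝ) l1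
    have d2 := (g.hasDerivAt_aeval (p.2 + 0 * c)).comp (0 : ℝ) l2
    refine HasDerivAt.congr_deriv (HasDerivAt.congr_of_eventuallyEq (d1.mul d2)
      (Filter.Eventually.of_forall fun t => ?_)) ?_
    · simp
    · simp; ring
  · intro p _
    unfold HasLineDerivAt
    have l1 : HasDerivAt (fun t : ℝ => p.1 + t * 1) 1 0 := by
      simpa using ((hasDerivAt_id (0 : ℝ)).mul_const 1).const_add p.1
    have l2 : HasDerivAt (fun t : ℝ => p.2 + t * c) c 0 := by
      simpa using ((hasDerivAt_id (0 : ℝ)).mul_const c).const_add p.2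
    have d := ((((l1.pow 2).sub ((l1.const_mul (2 * c)).mul l2)).add (l2.pow 2)).neg.div_const
      (2 * (1 - c ^ 2))).exp
    refine HasDerivAt.congr_deriv (HasDerivAt.congr_of_eventuallyEq (d)
      (Filter.Eventually.of_forall fun t => ?_)) ?_
    · simp [gw]
    · simp only [gw, Pi.add_apply, Pi.sub_apply, Pi.mul_apply, Pi.neg_apply, Pi.pow_apply, zero_mul,
        add_zero, mul_one]
      rw [mul_comm]
      congr 1
      field_simp
      norm_num
      ring

theorem gI_swap (c : ℝ) (f g : Polynomial ℤ) : gI c f g = gI c g f := by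
  unfold gI
  rw [Measure.volume_eq_prod, ← integral_prod_swap]
  congr 1
  ext p
  simp only [gw, Prod.fst_swap, Prod.snd_swap]
  rw [mul_comm (Polynomial.aeval p.2 f : ℝ)]
  congr 3
  ring

theorem gI_succ {c : ℝ} (hc : |c| < 1) (n : ℕ) (g : Polynomial ℤ) :
    gI c (Polynomial.hermite (n + 1)) g
      = c * gI c (Polynomial.hermite n) (Polynomial.derivative g) := by
  have h := gI_stein hc (Polynomial.hermite n) g
  have h2 : gI c (Polynomial.hermite (n + 1)) g = gI c (Polynomial.X * Polynomial.hermite n) g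
      - gI c (Polynomial.derivative (Polynomial.hermite n)) g := by
    unfold gI
    rw [← integral_sub (poly_gw_integrable hc _ _) (poly_gw_integrable hc _ _)]
    congr 1
    ext p
    rw [Polynomial.hermite_succ, map_sub]
    ring
  rw [h2, h]
  ring

theorem gI_natCast_mul (c : ℝ) (m : ℕ) (f g : Polynomial ℤ) :
    gI c f ((m : Polynomial ℤ) * g) = m * gI c f g := by
  unfold gI
  rw [← integral_const_mul]
  congr 1
  ext p
  simp
  ring

theorem gI_succ_zero {c : ℝ} (hc : |c| < 1) (n : ℕ) :
    gI c (Polynomial.hermite (n + 1)) (Polynomial.hermite 0) = 0 := by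
  rw [gI_succ hc]
  simp [gI]

theorem gI_zero {c : ℝ} (hc : |c| < 1) :
    gI c (Polynomial.hermite 0) (Polynomial.hermite 0) = 2 * Real.pi * Real.sqrt (1 - c ^ 2) := by
  have hs := one_sub_sq_pos hc
  have hi := poly_gw_integrable hc (Polynomial.hermite 0) (Polynomial.hermite 0)
  unfold gI
  rw [Measure.volume_eq_prod] at hi ⊢
  rw [integral_prod _ hi]
  have e : ∀ x y : ℝ, gw c (x, y) = Real.exp (-(1 / 2) * x ^ 2) *
      Real.exp (-(1 / (2 * (1 - c ^ 2))) * (y - c * x) ^ 2) := by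
    intro x y
    rw [← Real.exp_add, gw]
    congr 1
    field_simp
    ring
  simp only [Polynomial.hermite_zero, map_one, one_mul, e, integral_const_mul]
  have e2 : ∀ x : ℝ, ∫ y : ℝ, Real.exp (-(1 / (2 * (1 - c ^ 2))) * (y - c * x) ^ 2)
      = Real.sqrt (Real.pi / (1 / (2 * (1 - c ^ 2)))) := by
    intro x
    rw [integral_sub_right_eq_self
      (fun y : ℝ => Real.exp (-(1 / (2 * (1 - c ^ 2))) * y ^ 2)) (c * x), integral_gaussian]
  simp only [e2, integral_mul_const, integral_gaussian]
  rw [← Real.sqrt_mul (by positivity)]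
  have : Real.pi / (1 / 2) * (Real.pi / (1 / (2 * (1 - c ^ 2))))
      = (2 * Real.pi) ^ 2 * (1 - c ^ 2) := by
    field_simp
  rw [this, Real.sqrt_mul (by positivity), Real.sqrt_sq (by positivity)]

theorem gI_hermite {c : ℝ} (hc : |c| < 1) (n k : ℕ) :
    gI c (Polynomial.hermite n) (Polynomial.hermite k) =
      (2 * Real.pi * Real.sqrt (1 - c ^ 2)) *
        (if n = k then (n.factorial : ℝ) * c ^ n else 0) := by
  induction n generalizing k with
  | zero =>
    cases k with
    | zero => rw [gI_zero hc]; simp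
    | succ k => rw [gI_swap, gI_succ_zero hc]; simp
  | succ n ih =>
    cases k with
    | zero => rw [gI_succ_zero hc]; simp
    | succ k =>
      rw [gI_succ hc, hermite_derivative_succ, gI_natCast_mul, ih]
      by_cases h : n = k
      · subst h
        simp [Nat.factorial_succ]
        ring
      · simp [h]

/-- Orthogonality of the probabilists' Hermite polynomials with respect to the bivariate
Gaussian with covariance `[[1, c], [c, 1]]`:
`∬ Hₙ(x) Hₖ(y) dγ₂⁽ᶜ⁾(x,y) = δ_{n,k} n! cⁿ`. -/
theorem hermite_orthogonality_bivariate_gaussian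
    (c : ℝ) (hc : |c| < 1) (n k : ℕ) :
    ∫ p : ℝ × ℝ,
        ((Polynomial.aeval p.1) (Polynomial.hermite n) : ℝ) *
          ((Polynomial.aeval p.2) (Polynomial.hermite k) : ℝ) ∂(gaussian2D c)
      = if n = k then (n.factorial : ℝ) * c ^ n else 0 := by
  have hs := one_sub_sq_pos hc
  have hK : 0 < 2 * Real.pi * Real.sqrt (1 - c ^ 2) := by positivity
  have hm : Measurable fun p : ℝ × ℝ => ENNReal.ofReal
      ((1 / (2 * Real.pi * Real.sqrt (1 - c ^ 2))) *
        Real.exp (-(p.1 ^ 2 - 2 * c * p.1 * p.2 + p.2 ^ 2) / (2 * (1 - c ^ 2)))) := by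
    fun_prop
  rw [gaussian2D, integral_withDensity_eq_integral_toReal_smul hm
    (Filter.Eventually.of_forall fun p => ENNReal.ofReal_lt_top)]
  have e : ∀ p : ℝ × ℝ, (ENNReal.ofReal
      ((1 / (2 * Real.pi * Real.sqrt (1 - c ^ 2))) *
        Real.exp (-(p.1 ^ 2 - 2 * c * p.1 * p.2 + p.2 ^ 2) / (2 * (1 - c ^ 2))))).toReal •
      (((Polynomial.aeval p.1) (Polynomial.hermite n) : ℝ) *
          ((Polynomial.aeval p.2) (Polynomial.hermite k) : ℝ)) =
      (1 / (2 * Real.pi * Real.sqrt (1 - c ^ 2))) *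
      ((((Polynomial.aeval p.1) (Polynomial.hermite n) : ℝ) *
          ((Polynomial.aeval p.2) (Polynomial.hermite k) : ℝ)) * gw c p) := by
    intro p
    rw [ENNReal.toReal_ofReal (by positivity), smul_eq_mul, gw]
    ring
  simp only [e]
  rw [integral_const_mul]
  have := gI_hermite hc n k
  rw [gI] at this
  rw [this, ← mul_assoc, one_div, inv_mul_cancel₀ hK.ne', one_mul]
end

section
/- Let (M, 𝓕, σ) be a σ-finite measure space. Then the kernel K^{(σ)}(A, B) = exp(σ(A ∩ B) − (σ(A) + σ(B))/2) = exp(−(1/2)‖χ_A − χ_B‖²_{L²(σ)}) is positive semidefinite on the sets of finite σ-measure: for every n, all A₁, …, Aₙ ∈ 𝓕 with σ(Aᵢ) < ∞, and all c₁, …, cₙ ∈ ℂ, Σᵢ Σⱼ cᵢ conj(cⱼ) K^{(σ)}(Aᵢ, Aⱼ) is a nonnegative real number. -/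
open MeasureTheory

open scoped ComplexOrder in
/-- Entrywise powers of a positive semidefinite matrix are positive semidefinite (Schur). -/
lemma posSemidef_entrywise_pow {n : ℕ} {G : Matrix (Fin n) (Fin n) ℂ} (hG : G.PosSemidef) (k : ℕ) :
    (Matrix.of fun i j => G i j ^ k).PosSemidef := by
  induction k with
  | zero =>
    have h := Matrix.posSemidef_gram ℂ (fun _ : Fin n => (1 : ℂ))
    have e : (Matrix.of fun i j => G i j ^ 0) = Matrix.gram ℂ (fun _ : Fin n => (1 : ℂ)) := by
      ext i j
      simp
    rw [e]
    exact h
  | succ k ih =>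
    have h := ih.hadamard hG
    have e : (Matrix.of fun i j => G i j ^ (k + 1)) =
        (Matrix.of fun i j => G i j ^ k).hadamard G := by
      ext i j
      simp [pow_succ]
    rw [e]
    exact h

open scoped ComplexOrder in
lemma quadForm_exp_nonneg {n : ℕ} {G : Matrix (Fin n) (Fin n) ℂ} (hG : G.PosSemidef)
    (d : Fin n → ℂ) :
    0 ≤ ∑ i, ∑ j, d i * (starRingEnd ℂ) (d j) * Complex.exp (G i j) := by
  have hs : HasSum (fun k : ℕ => ∑ i, ∑ j, d i * (starRingEnd ℂ) (d j) *
      (G i j ^ k / (k.factorial : ℂ)))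
      (∑ i, ∑ j, d i * (starRingEnd ℂ) (d j) * Complex.exp (G i j)) := by
    refine hasSum_sum fun i _ => hasSum_sum fun j _ => HasSum.mul_left _ ?_
    rw [Complex.exp_eq_exp_ℂ]
    exact NormedSpace.expSeries_div_hasSum_exp (G i j)
  refine hs.nonneg fun k => ?_
  have h := (posSemidef_entrywise_pow hG k).dotProduct_mulVec_nonneg (star d)
  have hk : (0 : ℂ) ≤ ((k.factorial : ℂ))⁻¹ := by
    have : (0 : ℂ) ≤ (((k.factorial : ℝ)⁻¹ : ℝ) : ℂ) := by
      rw [Complex.zero_le_real]; positivity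
    simpa using this
  have h2 := mul_nonneg hk h
  convert h2 using 1
  simp only [dotProduct, Matrix.mulVec, Finset.mul_sum, star_star, Pi.star_apply, Matrix.of_apply]
  refine Finset.sum_congr rfl fun i _ => Finset.sum_congr rfl fun j _ => ?_
  rw [starRingEnd_apply]
  ring

/-- The kernel `K⁽σ⁾(A,B) = exp(σ(A ∩ B) − (σ(A)+σ(B))/2)` is positive semidefinite on
the sets of finite `σ`-measure: for complex coefficients `c i`, the double sum
`Σᵢ Σⱼ cᵢ conj(cⱼ) K⁽σ⁾(Aᵢ, Aⱼ)` is a nonnegative real number. -/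
theorem kernel_exp_posSemidef
    {M : Type*} [MeasurableSpace M] (σ : Measure M) [SigmaFinite σ]
    (n : ℕ) (A : Fin n → Set M) (hA : ∀ i, MeasurableSet (A i))
    (hfin : ∀ i, σ (A i) ≠ ⊤) (c : Fin n → ℂ) :
    0 ≤ (∑ i, ∑ j, c i * (starRingEnd ℂ) (c j) *
          Real.exp ((σ (A i ∩ A j)).toReal -
            ((σ (A i)).toReal + (σ (A j)).toReal) / 2)).re ∧
    (∑ i, ∑ j, c i * (starRingEnd ℂ) (c j) *
        Real.exp ((σ (A i ∩ A j)).toReal -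
          ((σ (A i)).toReal + (σ (A j)).toReal) / 2)).im = 0 := by
  open scoped ComplexOrder in
  have hG : (Matrix.gram ℂ (fun i => indicatorConstLp 2 (hA i) (hfin i) (1 : ℂ))).PosSemidef :=
    Matrix.posSemidef_gram ℂ _
  have h := quadForm_exp_nonneg hG
    (fun i => c i * ((Real.exp (-(σ (A i)).toReal / 2) : ℝ) : ℂ))
  have e : (∑ i, ∑ j, c i * (starRingEnd ℂ) (c j) *
        ((Real.exp ((σ (A i ∩ A j)).toReal -
          ((σ (A i)).toReal + (σ (A j)).toReal) / 2) : ℝ) : ℂ)) =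
      ∑ i, ∑ j, (c i * ((Real.exp (-(σ (A i)).toReal / 2) : ℝ) : ℂ)) *
        (starRingEnd ℂ) (c j * ((Real.exp (-(σ (A j)).toReal / 2) : ℝ) : ℂ)) *
        Complex.exp (Matrix.gram ℂ
          (fun i => indicatorConstLp 2 (hA i) (hfin i) (1 : ℂ)) i j) := by
    refine Finset.sum_congr rfl fun i _ => Finset.sum_congr rfl fun j _ => ?_
    rw [Matrix.gram_apply, L2.inner_indicatorConstLp_one_indicatorConstLp_one (hA i) (hA j) (hfin i) (hfin j)]
    have : (σ (A i ∩ A j)).toReal - ((σ (A i)).toReal + (σ (A j)).toReal) / 2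
      = -(σ (A i)).toReal / 2 + -(σ (A j)).toReal / 2 + (σ (A i ∩ A j)).toReal := by ring
    rw [this, Real.exp_add, Real.exp_add, map_mul, Complex.conj_ofReal]
    simp only [Measure.real, Complex.ofReal_mul, Complex.coe_algebraMap, Complex.ofReal_exp]
    ring
  rw [← e, Complex.le_def] at h
  exact ⟨h.1, h.2.symm⟩
end

section
/- Let σ be a tempered Borel measure on ℝ. Then there exists a continuous linear operator Q^{(σ)} from the Schwartz space 𝓢(ℝ, ℂ) into L²(ℝ, dx; ℂ) (Lebesgue measure) such that for every φ ∈ 𝓢(ℝ, ℂ), ∫_ℝ |(Q^{(σ)} φ)(x)|² dx = ∫_ℝ |φ̂(u)|² dσ(u), where φ̂(λ) = ∫_ℝ e^{−iλx} φ(x) dx is the Fourier transform. Consequently, with P_W the Wiener measure and f ↦ f̃ the Wiener integral (a centered Gaussian with E_{P_W}[|f̃|²] = ‖f‖²_{L²(ℝ)}), one has E_{P_W}[exp(i (Q^{(σ)}φ)~)] = exp(−(1/2)∫_ℝ |φ̂(u)|² dσ(u)). -/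
open MeasureTheory


theorem aux_temperate (σ : Measure ℝ) (p : ℕ)
    (h : (∫⁻ u, ENNReal.ofReal (1 / (u ^ 2 + 1) ^ p) ∂σ) < ⊤) : σ.HasTemperateGrowth := by
  refine ⟨2 * p, ?_⟩
  have hc : Continuous (fun u : ℝ => 1 / (u ^ 2 + 1) ^ p) := by
    refine continuous_const.div (by fun_prop) (fun u => by positivity)
  have hi : Integrable (fun u : ℝ => 1 / (u ^ 2 + 1) ^ p) σ := by
    refine ⟨hc.aestronglyMeasurable, ?_⟩
    rw [hasFiniteIntegral_iff_ofReal (Filter.Eventually.of_forall fun u => by positivity)]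
    exact h
  refine hi.mono' (Measurable.aestronglyMeasurable (by fun_prop)) (Filter.Eventually.of_forall fun u => ?_)
  rw [Real.norm_of_nonneg (by positivity), Real.rpow_neg (by positivity), Real.rpow_natCast,
    pow_mul, one_div]
  gcongr
  have := abs_nonneg u
  rw [Real.norm_eq_abs]
  nlinarith [sq_abs u]

theorem aux_sigmaFinite (σ : Measure ℝ) (p : ℕ)
    (h : (∫⁻ u, ENNReal.ofReal (1 / (u ^ 2 + 1) ^ p) ∂σ) < ⊤) : SigmaFinite σ := by
  have hm : Measurable (fun u : ℝ => ENNReal.ofReal (1 / (u ^ 2 + 1) ^ p)) := by fun_prop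
  have hf : IsFiniteMeasure (σ.withDensity (fun u : ℝ => ENNReal.ofReal (1 / (u ^ 2 + 1) ^ p))) :=
    isFiniteMeasure_withDensity h.ne
  rw [← withDensity_inv_same hm (μ := σ) (Filter.Eventually.of_forall fun u => by
    simp only [ne_eq, ENNReal.ofReal_eq_zero, not_le]; positivity)
    (Filter.Eventually.of_forall fun u => ENNReal.ofReal_ne_top)]
  refine SigmaFinite.withDensity_of_ne_top (Filter.Eventually.of_forall fun u => ?_)
  simp only [Pi.inv_apply, ne_eq, ENNReal.inv_eq_top, ENNReal.ofReal_eq_zero, not_le]; positivity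

theorem aux_orthonormal : ∃ v : ℕ → Lp ℂ 2 (volume : Measure ℝ), Orthonormal ℂ v := by
  refine ⟨fun n => indicatorConstLp 2 (s := Set.Ico (n:ℝ) (n+1)) measurableSet_Ico (by simp) 1, ?_⟩
  classical
  rw [orthonormal_iff_ite]
  intro i j
  rw [L2.inner_indicatorConstLp_one_indicatorConstLp_one _ _ (by simp) (by simp)]
  split_ifs with hij
  · subst hij; simp [Measure.real]
  · have : Set.Ico (i:ℝ) (i+1) ∩ Set.Ico (j:ℝ) (j+1) = ∅ := by
      ext x
      simp only [Set.mem_inter_iff, Set.mem_Ico, Set.mem_empty_iff_false, iff_false]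
      rintro ⟨⟨h1, h2⟩, h3, h4⟩
      apply hij
      have a : (i:ℝ) < j + 1 := by linarith
      have b : (j:ℝ) < i + 1 := by linarith
      norm_cast at a b
      omega
    simp [this]

theorem aux_embed {H K : Type*} [NormedAddCommGroup H] [InnerProductSpace ℂ H] [CompleteSpace H]
    [TopologicalSpace.SeparableSpace H] [NormedAddCommGroup K] [InnerProductSpace ℂ K]
    [CompleteSpace K] (v : ℕ → K) (hv : Orthonormal ℂ v) : Nonempty (H →ₗᵢ[ℂ] K) := by
  obtain ⟨w, b, hb⟩ := exists_hilbertBasis ℂ H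
  have hc : Countable w := by
    refine Pairwise.countable_of_isOpen_disjoint (s := fun i : w => Metric.ball (b i) (1/2)) ?_
      (fun i => Metric.isOpen_ball) (fun i => ⟨b i, Metric.mem_ball_self (by norm_num)⟩)
    intro i j hij
    apply Metric.ball_disjoint_ball
    have h0 := b.orthonormal.2 hij
    have h1 := b.orthonormal.1 i
    have h2 := b.orthonormal.1 j
    have := @norm_sub_sq ℂ H _ _ _ (b i) (b j)
    rw [h0, h1, h2] at this
    simp at this
    rw [dist_eq_norm]
    nlinarith [norm_nonneg (b i - b j)]
  obtain ⟨f, hf⟩ := hc.exists_injective_nat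
  have ho := (hv.comp f hf).orthogonalFamily
  exact ⟨ho.linearIsometry.comp b.repr.toLinearIsometry⟩

theorem aux_norm {μ : Measure ℝ} (f : Lp ℂ 2 μ) : ∫ x, ‖f x‖ ^ 2 ∂μ = ‖f‖ ^ 2 := by
  have := @inner_self_eq_norm_sq_to_K ℂ _ _ _ _ f
  rw [L2.inner_def] at this
  simp only [inner_self_eq_norm_sq_to_K] at this
  norm_cast at this

theorem exists_schwartz_to_L2_operator_tempered
    (σ : Measure ℝ)
    (htemp : ∃ p : ℕ, (∫⁻ u, ENNReal.ofReal (1 / (u ^ 2 + 1) ^ p) ∂σ) < ⊤) :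
    ∃ Q : SchwartzMap ℝ ℂ →L[ℂ] Lp ℂ 2 (volume : Measure ℝ),
      ∀ φ : SchwartzMap ℝ ℂ,
        ∫ x, ‖((Q φ : Lp ℂ 2 (volume : Measure ℝ)) : ℝ → ℂ) x‖ ^ 2
          = ∫ u, ‖∫ x : ℝ, Complex.exp (-(Complex.I * u * x)) * φ x‖ ^ 2 ∂σ := by
  obtain ⟨p, hp⟩ := htemp
  have := aux_temperate σ p hp
  have := aux_sigmaFinite σ p hp
  obtain ⟨v, hv⟩ := aux_orthonormal
  have : Fact ((2 : ENNReal) ≠ ⊤) := ⟨by simp⟩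
  obtain ⟨J⟩ := aux_embed (H := Lp ℂ 2 σ) v hv
  have hpi : (2 * Real.pi)⁻¹ ≠ 0 := by positivity
  let g : ℝ ≃L[ℝ] ℝ := ContinuousLinearEquiv.unitsEquivAut ℝ (Units.mk0 _ hpi)
  refine ⟨J.toContinuousLinearMap ∘L SchwartzMap.toLpCLM ℂ ℂ 2 σ ∘L
    SchwartzMap.compCLMOfContinuousLinearEquiv ℂ g ∘L FourierTransform.fourierCLM ℂ (SchwartzMap ℝ ℂ),
    fun φ => ?_⟩
  rw [aux_norm]
  simp only [ContinuousLinearMap.comp_apply, LinearIsometry.coe_toContinuousLinearMap,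
    LinearIsometry.norm_map, SchwartzMap.toLpCLM_apply]
  rw [← aux_norm]
  refine integral_congr_ae ?_
  filter_upwards [SchwartzMap.coeFn_toLp (SchwartzMap.compCLMOfContinuousLinearEquiv ℂ g
    (FourierTransform.fourierCLM ℂ (SchwartzMap ℝ ℂ) φ)) 2 σ] with u hu
  rw [hu, SchwartzMap.compCLMOfContinuousLinearEquiv_apply, Function.comp_apply,
    FourierTransform.fourierCLM_apply, SchwartzMap.fourier_coe,
    Real.fourier_real_eq_integral_exp_smul]
  congr 2
  refine integral_congr_ae (Filter.Eventually.of_forall fun x => ?_)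
  have hg : g u = u * (2 * Real.pi)⁻¹ := rfl
  simp only [hg, smul_eq_mul]
  congr 2
  have : -2 * Real.pi * x * (u * (2 * Real.pi)⁻¹) = -(u * x) := by
    field_simp
  rw [this]
  push_cast
  ring
end

section
/- Let σ be a tempered symmetric Borel measure on ℝ with ∫_ℝ (1 + u²)^{−1} dσ(u) < ∞, and define r_σ(t) = 4 ∫_ℝ (sin²(ut/2)/u²) dσ(u) (with integrand t²/4 at u = 0) and c(t, s) = (r_σ(t) + r_σ(s) − r_σ(t − s))/2. Then there is a unique probability measure Q_σ on the path space ℝ → ℝ, defined on the cylinder σ-algebra (the σ-algebra generated by the evaluation maps ω ↦ ω(t)), such that the coordinate process X_t^{(σ)}(ω) = ω(t) satisfies: X_0^{(σ)} = 0 Q_σ-almost surely, and for every finite family t₁, …, tₙ ∈ ℝ and λ₁, …, λₙ ∈ ℝ, ∫ exp(i Σⱼ λⱼ ω(tⱼ)) dQ_σ(ω) = exp(−(1/2) Σⱼ Σₖ λⱼ λₖ c(tⱼ, tₖ)); i.e. X^{(σ)} is a centered Gaussian process with E_{Q_σ}[X_t^{(σ)} X_s^{(σ)}] = c(t, s). 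-/
open MeasureTheory ProbabilityTheory

/-- L² continuity of the characteristic functional. -/
lemma cf_dist_le {Ω : Type*} [MeasurableSpace Ω] (P : Measure Ω) [IsProbabilityMeasure P]
    (f g : Lp ℝ 2 P) :
    ‖(∫ ω, Complex.exp (Complex.I * (f ω : ℂ)) ∂P) - ∫ ω, Complex.exp (Complex.I * (g ω : ℂ)) ∂P‖
      ≤ ‖f - g‖ := by
  have hi : ∀ f : Lp ℝ 2 P, Integrable (fun ω => Complex.exp (Complex.I * (f ω : ℂ))) P := by
    intro f
    refine Integrable.of_bound (C := 1) ?_ ?_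
    · have := (Lp.aestronglyMeasurable f)
      exact (by fun_prop : Continuous fun x : ℝ => Complex.exp (Complex.I * (x : ℂ))).comp_aestronglyMeasurable this
    · exact ae_of_all _ fun ω => by rw [mul_comm, Complex.norm_exp_ofReal_mul_I]
  rw [← integral_sub (hi f) (hi g)]
  have hpt : ∀ x y : ℝ, ‖Complex.exp (Complex.I * (x : ℂ)) - Complex.exp (Complex.I * (y : ℂ))‖ ≤ ‖x - y‖ := by
    intro x y
    have : Complex.exp (Complex.I * (x : ℂ)) - Complex.exp (Complex.I * (y : ℂ))
        = Complex.exp (Complex.I * (y : ℂ)) * (Complex.exp (Complex.I * ((x - y : ℝ) : ℂ)) - 1) := by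
      rw [mul_sub, ← Complex.exp_add]; push_cast; ring_nf
    rw [this, norm_mul]
    have h1 : ‖Complex.exp (Complex.I * (y : ℂ))‖ = 1 := by
      rw [mul_comm, Complex.norm_exp_ofReal_mul_I]
    rw [h1, one_mul]
    exact Real.norm_exp_I_mul_ofReal_sub_one_le
  have hm : MemLp (f - g : Lp ℝ 2 P) 2 P := Lp.memLp _
  have hm1 : MemLp (f - g : Lp ℝ 2 P) 1 P := hm.mono_exponent (by norm_num)
  have hle : eLpNorm (f - g : Lp ℝ 2 P) 1 P ≤ eLpNorm (f - g : Lp ℝ 2 P) 2 P :=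
    eLpNorm_le_eLpNorm_of_exponent_le (by norm_num) hm.1
  calc _ ≤ ∫ ω, ‖(f - g : Lp ℝ 2 P) ω‖ ∂P := by
        refine norm_integral_le_of_norm_le (memLp_one_iff_integrable.1 hm1).norm ?_
        filter_upwards [Lp.coeFn_sub f g] with ω hω
        rw [hω]; exact hpt _ _
    _ = (eLpNorm (f - g : Lp ℝ 2 P) 1 P).toReal := by
        rw [integral_norm_eq_lintegral_enorm hm.1, eLpNorm_one_eq_lintegral_enorm]
    _ ≤ _ := by
        rw [Lp.norm_def]; exact ENNReal.toReal_mono hm.2.ne hle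

/-- Isonormal Gaussian process over a real Hilbert space. -/
lemma exists_isonormal (H : Type) [NormedAddCommGroup H] [InnerProductSpace ℝ H]
    [CompleteSpace H] :
    ∃ (Ω : Type) (_ : MeasurableSpace Ω) (P : Measure Ω) (_ : IsProbabilityMeasure P)
      (T : H →ₗᵢ[ℝ] Lp ℝ 2 P), ∀ h : H,
      ∫ ω, Complex.exp (Complex.I * (T h ω : ℂ)) ∂P = Complex.exp (-(1 / 2 : ℂ) * ((‖h‖ ^ 2 : ℝ) : ℂ)) := by
  obtain ⟨w, b, -⟩ := exists_hilbertBasis ℝ H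
  let P : Measure (w → ℝ) := Measure.infinitePi fun _ => gaussianReal 0 1
  have hP : IsProbabilityMeasure P := by infer_instance
  have hme : ∀ i, AEMeasurable (fun ω : w → ℝ => ω i) P := fun i =>
    (measurable_pi_apply i).aemeasurable
  have hmap : ∀ i, P.map (fun ω => ω i) = gaussianReal 0 1 := fun i =>
    Measure.infinitePi_map_eval _ i
  have hind : iIndepFun (fun (i : w) (ω : w → ℝ) => ω i) P :=
    iIndepFun_infinitePi (X := fun x ω ↦ ω) (by fun_prop)
  have hmem : ∀ i, MemLp (fun ω : w → ℝ => ω i) 2 P := by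
    intro i
    have : MemLp id 2 (P.map (fun ω => ω i)) := by rw [hmap]; exact memLp_id_gaussianReal 2
    exact (memLp_map_measure_iff (by fun_prop) (hme i)).1 this
  have hmean : ∀ i, ∫ ω, ω i ∂P = 0 := by
    intro i
    have := integral_map (μ := P) (φ := fun ω => ω i) (hme i) (f := fun x : ℝ => x) (by fun_prop)
    rw [← this, hmap]; exact integral_id_gaussianReal
  have hvar : ∀ i, ∫ ω, ω i * ω i ∂P = 1 := by
    intro i
    have := integral_map (μ := P) (φ := fun ω => ω i) (hme i) (f := fun x : ℝ => x * x) (by fun_prop)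
    rw [← this, hmap]
    have h2 := variance_fun_id_gaussianReal (μ := 0) (v := 1)
    rw [variance_eq_integral (by fun_prop)] at h2
    simpa [integral_id_gaussianReal, pow_two] using h2
  let v : w → Lp ℝ 2 P := fun i => (hmem i).toLp _
  have hinner : ∀ i j, inner ℝ (v i) (v j) = ∫ ω, ω i * ω j ∂P := by
    intro i j
    rw [L2.inner_def]
    refine integral_congr_ae ?_
    filter_upwards [(hmem i).coeFn_toLp, (hmem j).coeFn_toLp] with ω h1 h2
    simp only [v]
    rw [h1, h2]; simp [mul_comm]
  have hv : Orthonormal ℝ v := by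
    classical
    rw [orthonormal_iff_ite]
    intro i j
    rw [hinner]
    split_ifs with h
    · subst h; exact hvar i
    · have := (hind.indepFun h).integral_fun_mul_eq_mul_integral
        (hme i).aestronglyMeasurable (hme j).aestronglyMeasurable
      rw [this, hmean, zero_mul]
  let T : H →ₗᵢ[ℝ] Lp ℝ 2 P := hv.orthogonalFamily.linearIsometry.comp b.repr.toLinearIsometry
  have hT : ∀ i, T (b i) = v i := by
    classical
    intro i
    have h0 : T (b i) = hv.orthogonalFamily.linearIsometry (b.repr (b i)) := rfl
    rw [h0, b.repr_self]
    refine (hv.orthogonalFamily.linearIsometry_apply_single (i := i) (1 : ℝ)).trans ?_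
    simp
  refine ⟨w → ℝ, inferInstance, P, hP, T, fun h => ?_⟩
  have hsum := b.hasSum_repr h
  let hs : Finset w → H := fun s => ∑ i ∈ s, b.repr h i • b i
  have hlim : Filter.Tendsto hs Filter.atTop (nhds h) := hsum
  have hcont : Continuous fun f : Lp ℝ 2 P => ∫ ω, Complex.exp (Complex.I * (f ω : ℂ)) ∂P := by
    refine (LipschitzWith.of_dist_le_mul (K := 1) fun f g => ?_).continuous
    rw [dist_eq_norm, dist_eq_norm]; simpa using cf_dist_le P f g
  have h1 := ((hcont.comp T.continuous).tendsto h).comp hlim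
  have h2 : Filter.Tendsto (fun s => Complex.exp (-(1 / 2 : ℂ) * ((‖hs s‖ ^ 2 : ℝ) : ℂ)))
      Filter.atTop (nhds (Complex.exp (-(1 / 2 : ℂ) * ((‖h‖ ^ 2 : ℝ) : ℂ)))) := by
    have : Continuous fun x : H => Complex.exp (-(1 / 2 : ℂ) * ((‖x‖ ^ 2 : ℝ) : ℂ)) := by fun_prop
    exact (this.tendsto h).comp hlim
  refine tendsto_nhds_unique h1 (h2.congr fun s => ?_)
  simp only [Function.comp]
  have hn : ‖hs s‖ ^ 2 = ∑ i ∈ s, b.repr h i ^ 2 := by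
    rw [← real_inner_self_eq_norm_sq]
    simp only [hs]
    rw [b.orthonormal.inner_sum]
    simp [pow_two]
  have hTs : (T (hs s) : (w → ℝ) → ℝ) =ᵐ[P] fun ω => ∑ i ∈ s, b.repr h i * ω i := by
    have : T (hs s) = ∑ i ∈ s, b.repr h i • v i := by simp [hs, hT]
    rw [this]
    refine (Lp.coeFn_finsetSum _ _).trans ?_
    have h3 : ∀ i ∈ s, ∀ᵐ ω ∂P, (b.repr h i • v i : Lp ℝ 2 P) ω = b.repr h i * ω i := by
      intro i _
      filter_upwards [Lp.coeFn_smul (b.repr h i) (v i), (hmem i).coeFn_toLp] with ω e1 e2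
      rw [e1, Pi.smul_apply, smul_eq_mul]; simp only [v]; rw [e2]
    filter_upwards [(Finset.eventually_all s).2 h3] with ω hω
    rw [Finset.sum_apply]
    exact Finset.sum_congr rfl hω
  rw [hn]
  symm
  calc _ = ∫ ω, Complex.exp (Complex.I * ((∑ i ∈ s, b.repr h i * ω i : ℝ) : ℂ)) ∂P := by
        refine integral_congr_ae ?_
        filter_upwards [hTs] with ω hω
        rw [hω]
    _ = ∫ ω, ∏ i : s, Complex.exp (Complex.I * ((b.repr h i * ω i : ℝ) : ℂ)) ∂P := by
        congr 1; ext ω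
        rw [← Complex.exp_sum, ← Finset.mul_sum, ← Complex.ofReal_sum, ← Finset.sum_coe_sort s]
    _ = ∏ i : s, ∫ ω, Complex.exp (Complex.I * ((b.repr h i * ω i : ℝ) : ℂ)) ∂P := by
        have hi' : iIndepFun (fun (i : s) (ω : w → ℝ) => ω i) P := hind.precomp Subtype.val_injective
        exact hi'.integral_fun_prod_comp (f := fun (i : s) (x : ℝ) => Complex.exp (Complex.I * ((b.repr h i * x : ℝ) : ℂ)))
          (fun i => hme i) (fun i => by fun_prop)
    _ = ∏ i : s, Complex.exp (-(1 / 2 : ℂ) * ((b.repr h i ^ 2 : ℝ) : ℂ)) := by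
        refine Finset.prod_congr rfl fun i _ => ?_
        have := integral_map (μ := P) (φ := fun ω => ω i) (hme i)
          (f := fun x : ℝ => Complex.exp (Complex.I * ((b.repr h i * x : ℝ) : ℂ))) (by fun_prop)
        rw [← this, hmap]
        have h5 := charFun_gaussianReal (μ := 0) (v := 1) (b.repr h i)
        rw [charFun_apply_real] at h5
        convert h5 using 1
        · congr 1; ext x; push_cast; ring_nf
        · push_cast; congr 1; ring
    _ = _ := by
        rw [← Complex.exp_sum, ← Finset.mul_sum, ← Complex.ofReal_sum, ← Finset.sum_coe_sort s]

/-- The (rotated) Fourier transform of the indicator of `[0,t]`. -/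
noncomputable def fker (t u : ℝ) : ℂ :=
  if u = 0 then (t : ℂ) else (Complex.exp (Complex.I * ((u * t : ℝ) : ℂ)) - 1) / (u : ℂ)

lemma fker_sub_sq (t s u : ℝ) : ‖fker t u - fker s u‖ ^ 2 =
    4 * (if u = 0 then (t - s) ^ 2 / 4 else Real.sin (u * (t - s) / 2) ^ 2 / u ^ 2) := by
  unfold fker
  split_ifs with h
  · rw [← Complex.ofReal_sub, Complex.norm_real, Real.norm_eq_abs, sq_abs]; ring
  · have : (Complex.exp (Complex.I * ((u * t : ℝ) : ℂ)) - 1) / (u : ℂ)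
        - (Complex.exp (Complex.I * ((u * s : ℝ) : ℂ)) - 1) / (u : ℂ)
        = Complex.exp (Complex.I * ((u * s : ℝ) : ℂ)) *
          (Complex.exp (Complex.I * ((u * (t - s) : ℝ) : ℂ)) - 1) / (u : ℂ) := by
      rw [mul_sub, ← Complex.exp_add, ← sub_div]; push_cast; ring_nf
    have h1 : ‖Complex.exp (Complex.I * ((u * s : ℝ) : ℂ))‖ = 1 := by
      rw [mul_comm, Complex.norm_exp_ofReal_mul_I]
    rw [this, norm_div, norm_mul, h1, one_mul, Complex.norm_exp_I_mul_ofReal_sub_one,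
      Complex.norm_real, div_pow, Real.norm_eq_abs, Real.norm_eq_abs, sq_abs, sq_abs]
    ring

lemma fker_zero (u : ℝ) : fker 0 u = 0 := by
  unfold fker; split_ifs <;> simp

lemma measurable_fker (t : ℝ) : Measurable (fker t) := by
  unfold fker
  exact Measurable.ite (measurableSet_singleton 0) (by fun_prop) (by fun_prop)

lemma fker_bound (t u : ℝ) : ‖fker t u‖ ^ 2 ≤ (t ^ 2 + 4) * (1 / (1 + u ^ 2)) := by
  have h := fker_sub_sq t 0 u
  rw [fker_zero, sub_zero, sub_zero] at h
  rw [h, mul_one_div, le_div_iff₀ (by positivity)]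
  split_ifs with hu
  · subst hu; nlinarith
  · have hu2 : 0 < u ^ 2 := by positivity
    have h1 : Real.sin (u * t / 2) ^ 2 ≤ 1 := Real.sin_sq_le_one _
    have h2 : Real.sin (u * t / 2) ^ 2 ≤ (u * t / 2) ^ 2 := by
      rw [← sq_abs, ← sq_abs (u * t / 2)]
      exact pow_le_pow_left₀ (abs_nonneg _) Real.abs_sin_le_abs 2
    have h3 : 4 * (Real.sin (u * t / 2) ^ 2 / u ^ 2) * (1 + u ^ 2)
        = 4 * Real.sin (u * t / 2) ^ 2 / u ^ 2 + 4 * Real.sin (u * t / 2) ^ 2 := by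
      field_simp
    have h4 : 4 * Real.sin (u * t / 2) ^ 2 / u ^ 2 ≤ t ^ 2 := by
      rw [div_le_iff₀ hu2]; nlinarith
    rw [h3]; linarith

lemma memLp_fker (σ : Measure ℝ)
    (htemp : (∫⁻ u, ENNReal.ofReal (1 / (1 + u ^ 2)) ∂σ) < ⊤) (t : ℝ) :
    MemLp (fker t) 2 σ := by
  rw [← memLp_norm_iff (measurable_fker t).aestronglyMeasurable,
    memLp_two_iff_integrable_sq (measurable_fker t).norm.aestronglyMeasurable]
  have hi : Integrable (fun u : ℝ => 1 / (1 + u ^ 2)) σ := by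
    refine ⟨(by fun_prop : Measurable fun u : ℝ => 1 / (1 + u ^ 2)).aestronglyMeasurable, ?_⟩
    rw [hasFiniteIntegral_iff_ofReal (ae_of_all _ fun u => by positivity)]
    exact htemp
  refine (hi.const_mul (t ^ 2 + 4)).mono'
    ((measurable_fker t).norm.pow_const 2).aestronglyMeasurable (ae_of_all _ fun u => ?_)
  rw [Real.norm_of_nonneg (by positivity)]
  exact fker_bound t u

lemma norm_toLp_sq (σ : Measure ℝ) (f : ℝ → ℂ) (hf : MemLp f 2 σ) :
    ‖hf.toLp f‖ ^ 2 = ∫ u, ‖f u‖ ^ 2 ∂σ := by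
  rw [← real_inner_self_eq_norm_sq, L2.inner_def]
  refine integral_congr_ae ?_
  filter_upwards [hf.coeFn_toLp] with u hu
  rw [hu, real_inner_self_eq_norm_sq]

/-- Uniqueness: finite-dimensional characteristic functions determine the law. -/
lemma ext_of_fdd (Q Q' : Measure (ℝ → ℝ)) [IsProbabilityMeasure Q] [IsProbabilityMeasure Q']
    (h : ∀ (n : ℕ) (t lam : Fin n → ℝ),
      ∫ ω : ℝ → ℝ, Complex.exp (Complex.I * ((∑ j, lam j * ω (t j) : ℝ) : ℂ)) ∂Q
        = ∫ ω : ℝ → ℝ, Complex.exp (Complex.I * ((∑ j, lam j * ω (t j) : ℝ) : ℂ)) ∂Q') :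
    Q = Q' := by
  have hlim : IsProjectiveLimit Q' (fun I : Finset ℝ => Q'.map I.restrict) := fun I => rfl
  have hpr : ∀ I : Finset ℝ, IsProbabilityMeasure (Q'.map I.restrict) := fun I =>
    Measure.isProbabilityMeasure_map (Finset.measurable_restrict I).aemeasurable
  refine IsProjectiveLimit.unique (P := fun I : Finset ℝ => Q'.map I.restrict) (fun I => ?_) hlim
  have := Measure.isProbabilityMeasure_map (μ := Q) (Finset.measurable_restrict (X := fun _ => ℝ) I).aemeasurable
  refine Measure.ext_of_charFunDual (funext fun L => ?_)
  classical
  have hL : ∀ x : I → ℝ, L x = ∑ i, L (Pi.single i 1) * x i := by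
    intro x
    conv_lhs => rw [← Finset.univ_sum_single x, map_sum]
    refine Finset.sum_congr rfl fun i _ => ?_
    have : (Pi.single i (x i) : I → ℝ) = x i • Pi.single i 1 := by
      rw [← Pi.single_smul]; simp
    rw [this, map_smul, smul_eq_mul, mul_comm]
  have key : ∀ ν : Measure (ℝ → ℝ), charFunDual (ν.map I.restrict) L =
      ∫ ω : ℝ → ℝ, Complex.exp (Complex.I * ((∑ j : Fin (Fintype.card I),
        L (Pi.single ((Fintype.equivFin I).symm j) 1) * ω ((Fintype.equivFin I).symm j) : ℝ) : ℂ)) ∂ν := by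
    intro ν
    rw [charFunDual_apply, integral_map (Finset.measurable_restrict I).aemeasurable
      (by fun_prop)]
    congr 1; ext ω
    rw [hL, mul_comm, ← (Fintype.equivFin I).symm.sum_comp]
    rfl
  rw [key, key]
  exact h _ _ _

/-- Kolmogorov (path-space) realization of the stationary-increment Gaussian process
attached to a tempered symmetric measure `σ`: with
`r(t) = 4∫ sin²(ut/2)/u² dσ(u)` and `c(t,s) = (r(t) + r(s) − r(t−s))/2`, there is a
unique probability measure `Q_σ` on `ℝ → ℝ` (with its product/cylinder σ-algebra) under
which the coordinate process vanishes at `0` a.s. and has the centered Gaussian joint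
characteristic functions with covariance `c`. -/
theorem kolmogorov_realization_stationary_increments
    (σ : Measure ℝ)
    (htemp : (∫⁻ u, ENNReal.ofReal (1 / (1 + u ^ 2)) ∂σ) < ⊤)
    (hsymm : ∀ A : Set ℝ, MeasurableSet A → σ A = σ (-A))
    (r : ℝ → ℝ)
    (hr : ∀ t, r t
      = 4 * ∫ u, (if u = 0 then t ^ 2 / 4 else Real.sin (u * t / 2) ^ 2 / u ^ 2) ∂σ)
    (c : ℝ → ℝ → ℝ)
    (hc : ∀ t s, c t s = (r t + r s - r (t - s)) / 2) :
    ∃! Q : Measure (ℝ → ℝ),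
      Q Set.univ = 1 ∧
      Q {ω : ℝ → ℝ | ω 0 = 0} = 1 ∧
      ∀ (n : ℕ) (t lam : Fin n → ℝ),
        ∫ ω : ℝ → ℝ, Complex.exp (Complex.I * ((∑ j, lam j * ω (t j) : ℝ) : ℂ)) ∂Q
          = Complex.exp (-(1 / 2 : ℂ) *
              ((∑ j, ∑ k, lam j * lam k * c (t j) (t k) : ℝ) : ℂ)) := by
  have hF : ∀ t, MemLp (fker t) 2 σ := memLp_fker σ htemp
  let F : ℝ → Lp ℂ 2 σ := fun t => (hF t).toLp _
  have hF0 : F 0 = 0 := by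
    have : F 0 = (MemLp.zero : MemLp (0 : ℝ → ℂ) 2 σ).toLp 0 :=
      MemLp.toLp_congr _ _ (ae_of_all _ fun u => fker_zero u)
    rw [this]; rfl
  have hsub : ∀ t s, ‖F t - F s‖ ^ 2 = r (t - s) := by
    intro t s
    have : F t - F s = ((hF t).sub (hF s)).toLp _ := (MemLp.toLp_sub _ _).symm
    rw [this, norm_toLp_sq, hr, ← integral_const_mul]
    congr 1; ext u
    exact fker_sub_sq t s u
  have hn : ∀ t, ‖F t‖ ^ 2 = r t := by
    intro t
    have := hsub t 0
    rwa [hF0, sub_zero, sub_zero] at this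
  have hcov : ∀ t s, c t s = inner ℝ (F t) (F s) := by
    intro t s
    rw [hc, ← hn, ← hn, ← hsub, norm_sub_sq_real]; ring
  obtain ⟨Ω, mΩ, P, hP, T, hT⟩ := exists_isonormal (Lp ℂ 2 σ)
  let X : Ω → ℝ → ℝ := fun ω t => T (F t) ω
  have hX : Measurable X := measurable_pi_iff.2 fun t => (Lp.stronglyMeasurable (T (F t))).measurable
  have hQ : IsProbabilityMeasure (P.map X) := Measure.isProbabilityMeasure_map hX.aemeasurable
  have hcf : ∀ (n : ℕ) (t lam : Fin n → ℝ),
        ∫ ω : ℝ → ℝ, Complex.exp (Complex.I * ((∑ j, lam j * ω (t j) : ℝ) : ℂ)) ∂(P.map X)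
          = Complex.exp (-(1 / 2 : ℂ) *
              ((∑ j, ∑ k, lam j * lam k * c (t j) (t k) : ℝ) : ℂ)) := by
    intro n t lam
    have hmeas : Measurable fun ω : ℝ → ℝ =>
        Complex.exp (Complex.I * ((∑ j, lam j * ω (t j) : ℝ) : ℂ)) := by fun_prop
    rw [integral_map hX.aemeasurable hmeas.aestronglyMeasurable]
    have hnorm : ‖∑ j, lam j • F (t j)‖ ^ 2 = ∑ j, ∑ k, lam j * lam k * c (t j) (t k) := by
      rw [← real_inner_self_eq_norm_sq, sum_inner]
      refine Finset.sum_congr rfl fun j _ => ?_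
      rw [inner_sum]
      refine Finset.sum_congr rfl fun k _ => ?_
      rw [real_inner_smul_left, real_inner_smul_right, hcov]; ring
    rw [← hnorm, ← hT]
    refine integral_congr_ae ?_
    have h1 : T (∑ j, lam j • F (t j)) = ∑ j, lam j • T (F (t j)) := by simp
    rw [h1]
    have h2 : ∀ᵐ ω ∂P, ∀ j, (lam j • T (F (t j)) : Lp ℝ 2 P) ω = lam j * T (F (t j)) ω := by
      rw [ae_all_iff]
      intro j
      filter_upwards [Lp.coeFn_smul (lam j) (T (F (t j)))] with ω e
      rw [e]; rfl
    filter_upwards [h2, Lp.coeFn_finsetSum Finset.univ fun j => lam j • T (F (t j))] with ω e1 e2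
    rw [e2, Finset.sum_apply]
    simp only [e1, X]
  refine ⟨P.map X, ⟨measure_univ, ?_, hcf⟩, ?_⟩
  · have hms : MeasurableSet {ω : ℝ → ℝ | ω 0 = 0} :=
      measurableSet_eq_fun (measurable_pi_apply (0 : ℝ)) measurable_const
    rw [Measure.map_apply hX hms]
    have : T (F 0) = 0 := by rw [hF0, map_zero]
    have h0 : ∀ᵐ ω ∂P, T (F 0) ω = 0 := by
      rw [this]; exact Lp.coeFn_zero _ _ _
    exact (prob_compl_eq_zero_iff (hX hms)).1 h0
  · rintro Q' ⟨h1, -, h3⟩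
    have : IsProbabilityMeasure Q' := ⟨h1⟩
    exact ext_of_fdd _ _ fun n t lam => (h3 n t lam).trans (hcf n t lam).symm
end
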